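/- Let X be an infinite T1 topological space. Then ψ(X) ≤ nu(X)·2^(s(X)) (cardinal arithmetic). -/

import Mathlib

open Cardinal Set

/-- A nonempty subset `A` of a topological space is finitely non-Hausdorff if for every
nonempty finite subset `F` of `A` and every choice of open neighborhoods of the points
of `F`, the intersection of these neighborhoods is nonempty. -/
def FinNonHausdorff (X : Type*) [TopologicalSpace X] (A : Set X) : Prop :=
  A.Nonempty ∧ ∀ F : Finset X, (F : Set X) ⊆ A → F.Nonempty →
    ∀ U : X → Set X, (∀ x ∈ F, IsOpen (U x) ∧ x ∈ U x) →
      (⋂ x ∈ F, U x).Nonempty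

/-- A maximal finitely non-Hausdorff subset. -/
def MaxFinNonHausdorff (X : Type*) [TopologicalSpace X] (A : Set X) : Prop :=
  FinNonHausdorff X A ∧ ∀ B : Set X, FinNonHausdorff X B → A ⊆ B → A = B

/-- The non-Hausdorff number `nh(X)`. -/
noncomputable def nh (X : Type*) [TopologicalSpace X] : Cardinal :=
  1 + ⨆ A : {A : Set X // FinNonHausdorff X A}, #A.1

/-- A nonempty subset `A` is finitely non-Urysohn if for every nonempty finite subset `F`
of `A` and every choice of open neighborhoods of the points of `F`, the intersection of
the closures of these neighborhoods is nonempty. -/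
def FinNonUrysohn (X : Type*) [TopologicalSpace X] (A : Set X) : Prop :=
  A.Nonempty ∧ ∀ F : Finset X, (F : Set X) ⊆ A → F.Nonempty →
    ∀ U : X → Set X, (∀ x ∈ F, IsOpen (U x) ∧ x ∈ U x) →
      (⋂ x ∈ F, closure (U x)).Nonempty

/-- The non-Urysohn number `nu(X)`. -/
noncomputable def nu (X : Type*) [TopologicalSpace X] : Cardinal :=
  1 + ⨆ A : {A : Set X // FinNonUrysohn X A}, #A.1

/-- The θ-closure of the singleton `{x}`. -/
def thetaClosSingleton (X : Type*) [TopologicalSpace X] (x : X) : Set X :=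
  {y | ∀ U : Set X, IsOpen U → y ∈ U → x ∈ closure U}

/-- The non-Urysohn number of `X` with respect to singletons, `nu_s(X)`. -/
noncomputable def nuS (X : Type*) [TopologicalSpace X] : Cardinal :=
  1 + ⨆ x : X, #(thetaClosSingleton X x)

/-- The cellularity `c(X)`. -/
noncomputable def cellularity (X : Type*) [TopologicalSpace X] : Cardinal :=
  ℵ₀ + ⨆ 𝒰 : {𝒰 : Set (Set X) //
      (∀ U ∈ 𝒰, IsOpen U ∧ U.Nonempty) ∧ 𝒰.PairwiseDisjoint id}, #𝒰.1

/-- The character `χ(X)`. -/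
noncomputable def character (X : Type*) [TopologicalSpace X] : Cardinal :=
  ⨆ x : X, sInf {c : Cardinal | ∃ B : Set (Set X), #B = c ∧
    (∀ U ∈ B, IsOpen U ∧ x ∈ U) ∧ ∀ V : Set X, IsOpen V → x ∈ V → ∃ U ∈ B, U ⊆ V}

/-- The spread `s(X)`. -/
noncomputable def spread (X : Type*) [TopologicalSpace X] : Cardinal :=
  ℵ₀ + ⨆ D : {D : Set X // DiscreteTopology D}, #D.1

/-- The pseudocharacter `ψ(X)` of a `T₁` space. -/
noncomputable def pseudoCharacter (X : Type*) [TopologicalSpace X] : Cardinal :=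
  ⨆ x : X, sInf {c : Cardinal | ∃ S : Set (Set X), #S = c ∧
    (∀ U ∈ S, IsOpen U) ∧ ⋂₀ S = {x}}

/-- Šapirovskiĭ's lemma: a neighborhood assignment on `Y` admits a discrete `D ⊆ Y` whose closure,
together with the neighborhoods assigned to the points of `D`, covers `Y`. -/
theorem exists_discrete_subset_closure_union {X : Type*} [TopologicalSpace X] (Y : Set X)
    (V : X → Set X) (hV : ∀ y ∈ Y, IsOpen (V y) ∧ y ∈ V y) :
    ∃ D ⊆ Y, DiscreteTopology D ∧ Y ⊆ closure D ∪ ⋃ y ∈ D, V y := by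
  let r : X → X → Prop := WellOrderingRel
  have wf : WellFounded r := IsWellFounded.wf
  let step : ∀ y : X, (∀ z, r z y → Prop) → Prop := fun y P =>
    y ∈ Y ∧ y ∉ closure {z | ∃ h : r z y, P z h} ∧ ∀ z (h : r z y), P z h → y ∉ V z
  let D : Set X := {y | wf.fix step y}
  have mem_D (y : X) : y ∈ D ↔
      y ∈ Y ∧ y ∉ closure {z | r z y ∧ z ∈ D} ∧ ∀ z, r z y → z ∈ D → y ∉ V z := by
    change wf.fix step y ↔ _
    rw [wf.fix_eq]
    simp only [step, exists_prop]
    rfl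
  refine ⟨D, fun y hy => ((mem_D y).1 hy).1, ?_, ?_⟩
  · rw [discreteTopology_iff_isOpen_singleton]
    rintro ⟨y, hy⟩
    obtain ⟨hyY, hcl, -⟩ := (mem_D y).1 hy
    refine ⟨V y \ closure {z | r z y ∧ z ∈ D}, (hV y hyY).1.sdiff isClosed_closure, ?_⟩
    ext ⟨z, hz⟩
    simp only [mem_preimage, mem_sdiff, mem_singleton_iff, Subtype.mk.injEq]
    constructor
    · rintro ⟨hzV, hzcl⟩
      rcases trichotomous_of r z y with h | h | h
      · exact (hzcl (subset_closure (And.intro h hz))).elim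
      · exact h
      · exact absurd hzV (((mem_D z).1 hz).2.2 y h hy)
    · rintro rfl
      exact ⟨(hV z hyY).2, hcl⟩
  · intro y hy
    by_contra hcov
    simp only [mem_union, mem_iUnion, not_or, not_exists] at hcov
    have hyD : y ∈ D := (mem_D y).2
      ⟨hy, fun h => hcov.1 (closure_mono (fun z hz => hz.2) h), fun z _ hz => hcov.2 z hz⟩
    exact hcov.1 (subset_closure hyD)

/-- The θ-closure of a singleton is finitely non-Urysohn. -/
theorem finNonUrysohn_thetaClosSingleton {X : Type*} [TopologicalSpace X] (x : X) :
    FinNonUrysohn X (thetaClosSingleton X x) := by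
  refine ⟨⟨x, fun U _ hx => subset_closure hx⟩, fun F hF _ U hU => ⟨x, ?_⟩⟩
  simp only [mem_iInter]
  exact fun y hy => hF hy (U y) (hU y hy).1 (hU y hy).2

theorem FinNonUrysohn.mk_le_nu {X : Type*} [TopologicalSpace X] {A : Set X}
    (hA : FinNonUrysohn X A) : #A ≤ nu X :=
  (le_ciSup (f := fun A : {A : Set X // FinNonUrysohn X A} => #A.1)
    (bddAbove_of_small) ⟨A, hA⟩).trans le_add_self

theorem mk_le_spread {X : Type*} [TopologicalSpace X] (D : Set X) [hD : DiscreteTopology D] :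
    #D ≤ spread X :=
  (le_ciSup (f := fun D : {D : Set X // DiscreteTopology D} => #D.1)
    (bddAbove_of_small) ⟨D, hD⟩).trans le_add_self

/-- In a `T₁` space each point is an intersection of few open sets, counted in terms of its
θ-closure and a discrete subspace. -/
theorem exists_open_sInter_eq_singleton {X : Type*} [TopologicalSpace X] [T1Space X] (x : X) :
    ∃ S : Set (Set X), #S ≤ nu X + (2 ^ spread X + spread X) ∧
      (∀ U ∈ S, IsOpen U) ∧ ⋂₀ S = {x} := by
  have hsep : ∀ y, ∃ V : Set X, y ∈ (thetaClosSingleton X x)ᶜ →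
      (IsOpen V ∧ y ∈ V) ∧ x ∉ closure V := by
    intro y
    by_cases hy : y ∈ thetaClosSingleton X x
    · exact ⟨∅, fun h => absurd hy h⟩
    · simp only [thetaClosSingleton, mem_ofPred_eq, not_forall] at hy
      obtain ⟨V, hVo, hyV, hxV⟩ := hy
      exact ⟨V, fun _ => ⟨⟨hVo, hyV⟩, hxV⟩⟩
  choose V hV using hsep
  obtain ⟨D, hDY, hD, hcov⟩ :=
    exists_discrete_subset_closure_union _ V fun y hy => (hV y hy).1
  let S₁ : Set (Set X) := (fun y => {y}ᶜ) '' (thetaClosSingleton X x \ {x})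
  let S₂ : Set (Set X) := (fun A => (closure A)ᶜ) '' {A ∈ 𝒫 D | x ∉ closure A}
  let S₃ : Set (Set X) := (fun y => (closure (V y))ᶜ) '' D
  have h₁ : #S₁ ≤ nu X := (mk_image_le.trans (mk_le_mk_of_subset sdiff_subset)).trans
    (finNonUrysohn_thetaClosSingleton x).mk_le_nu
  have h₂ : #S₂ ≤ 2 ^ spread X := by
    refine (mk_image_le.trans (mk_le_mk_of_subset (sep_subset _ _))).trans ?_
    rw [mk_powerset]
    exact power_le_power_left two_ne_zero (mk_le_spread D)
  have h₃ : #S₃ ≤ spread X := mk_image_le.trans (mk_le_spread D)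
  refine ⟨S₁ ∪ (S₂ ∪ S₃), ?_, ?_, ?_⟩
  · exact (mk_union_le _ _).trans
      (add_le_add h₁ ((mk_union_le _ _).trans (add_le_add h₂ h₃)))
  · rintro U (⟨y, -, rfl⟩ | ⟨A, -, rfl⟩ | ⟨y, -, rfl⟩)
    · exact isOpen_compl_singleton
    · exact isClosed_closure.isOpen_compl
    · exact isClosed_closure.isOpen_compl
  · refine Subset.antisymm (fun z hz => ?_) (singleton_subset_iff.2 ?_)
    · by_contra hzx
      by_cases hzθ : z ∈ thetaClosSingleton X x
      · exact hz _ (Or.inl ⟨z, ⟨hzθ, hzx⟩, rfl⟩) rfl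
      · obtain ⟨⟨hVo, hzV⟩, hxV⟩ := hV z hzθ
        rcases hcov hzθ with hzD | hzD
        · refine hz _ (Or.inr (Or.inl ⟨D ∩ V z, ⟨inter_subset_left, ?_⟩, rfl⟩)) ?_
          · exact fun h => hxV (closure_mono inter_subset_right h)
          · rw [inter_comm]
            exact hVo.inter_closure ⟨hzV, hzD⟩
        · simp only [mem_iUnion] at hzD
          obtain ⟨y, hyD, hzy⟩ := hzD
          exact hz _ (Or.inr (Or.inr ⟨y, hyD, rfl⟩)) (subset_closure hzy)
    · rintro U (⟨y, hy, rfl⟩ | ⟨A, hA, rfl⟩ | ⟨y, hy, rfl⟩)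
      · exact fun h => hy.2 (Eq.symm h)
      · exact hA.2
      · exact (hV y (hDY hy)).2

theorem statement6 (X : Type*) [TopologicalSpace X] [T1Space X] [Infinite X] :
    pseudoCharacter X ≤ nu X * 2 ^ spread X := by
  have hs : ℵ₀ ≤ (2 : Cardinal) ^ spread X :=
    (le_self_add : ℵ₀ ≤ spread X).trans (cantor _).le
  have hnu : (1 : Cardinal) ≤ nu X := le_self_add
  refine ciSup_le' fun x => ?_
  obtain ⟨S, hcard, hopen, hinter⟩ := exists_open_sInter_eq_singleton x
  refine le_trans (csInf_le' (a := #S) ⟨S, rfl, hopen, hinter⟩) (hcard.trans ?_)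
  refine add_le_of_le (hs.trans (le_mul_of_one_le_left' hnu)) ?_ ?_
  · exact le_mul_of_one_le_right' (one_le_aleph0.trans hs)
  · rw [add_eq_left hs (cantor _).le]
    exact le_mul_of_one_le_left' hnu
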